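/- The truncation deflation factor is strictly between 0 and 1: for every s ∈ ℝ, 0 < ψ(s) < 1, where ψ(s) = λ(s)(λ(s) − s) and λ(s) = φ(s)/(1−Φ(s)) is the standard normal hazard function. -/

import Mathlib

open MeasureTheory ProbabilityTheory

/-- Standard normal pdf. -/
noncomputable def stdPhi (s : ℝ) : ℝ := (Real.sqrt (2 * Real.pi))⁻¹ * Real.exp (-(s ^ 2) / 2)

/-- Standard normal cdf. -/
noncomputable def stdPhiCDF (s : ℝ) : ℝ := ∫ t in Set.Iic s, stdPhi t

/-- Standard normal hazard function `λ(s) = φ(s)/(1 − Φ(s))`. -/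
noncomputable def hazardN (s : ℝ) : ℝ := stdPhi s / (1 - stdPhiCDF s)

/-- Truncation deflation factor `ψ(s) = λ(s)(λ(s) − s)`. -/
noncomputable def psiN (s : ℝ) : ℝ := hazardN s * (hazardN s - s)

/-- Covariance of two real random variables under a measure. -/
noncomputable def covM {Ω : Type*} [MeasurableSpace Ω] (μ : Measure Ω) (X Y : Ω → ℝ) : ℝ :=
  (∫ ω, X ω * Y ω ∂μ) - (∫ ω, X ω ∂μ) * (∫ ω, Y ω ∂μ)

/-- Partial covariance, adjusting for a standardized covariate `S`. -/
noncomputable def covAdj {Ω : Type*} [MeasurableSpace Ω] (μ : Measure Ω) (X Y S : Ω → ℝ) : ℝ :=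
  covM μ X Y - covM μ X S * covM μ Y S

lemma stdPhi_pos (t : ℝ) : 0 < stdPhi t := by
  unfold stdPhi
  positivity

lemma stdPhi_eq_gaussianPDFReal : stdPhi = gaussianPDFReal 0 1 := by
  ext t
  simp [stdPhi, gaussianPDFReal]

lemma stdPhi_eq_const_mul_exp (t : ℝ) :
    stdPhi t = (Real.sqrt (2 * Real.pi))⁻¹ * Real.exp (-(1 / 2) * t ^ 2) := by
  unfold stdPhi
  ring_nf

lemma hasDerivAt_stdPhi (t : ℝ) : HasDerivAt stdPhi (-(t * stdPhi t)) t := by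
  have h : HasDerivAt (fun x : ℝ => -(x ^ 2) / 2) (-t) t :=
    ((hasDerivAt_pow 2 t).neg.div_const 2).congr_deriv (by norm_num; ring)
  refine (h.exp.const_mul (Real.sqrt (2 * Real.pi))⁻¹).congr_deriv ?_
  unfold stdPhi
  ring

lemma integrable_pow_mul_stdPhi (n : ℕ) : Integrable (fun t : ℝ => t ^ n * stdPhi t) := by
  have hn : (-1 : ℝ) < n := by
    linarith [n.cast_nonneg (α := ℝ)]
  have h := (integrable_rpow_mul_exp_neg_mul_sq (b := 1 / 2) (by norm_num) hn).const_mul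
    (Real.sqrt (2 * Real.pi))⁻¹
  refine h.congr (ae_of_all _ fun t => ?_)
  simp only [stdPhi_eq_const_mul_exp, Real.rpow_natCast]
  ring

lemma tendsto_pow_mul_stdPhi_atTop (n : ℕ) :
    Filter.Tendsto (fun t : ℝ => t ^ n * stdPhi t) Filter.atTop (nhds 0) := by
  have h := ((tendsto_rpow_abs_mul_exp_neg_mul_sq_cocompact (a := 1 / 2) (by norm_num)
    (n : ℝ)).mono_left atTop_le_cocompact).const_mul (Real.sqrt (2 * Real.pi))⁻¹
  rw [mul_zero] at h
  refine h.congr' ?_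
  filter_upwards [Filter.eventually_ge_atTop 0] with t ht
  rw [stdPhi_eq_const_mul_exp, Real.rpow_natCast, abs_of_nonneg ht]
  ring

lemma setIntegral_Ioi_stdPhi (s : ℝ) : ∫ t in Set.Ioi s, stdPhi t = 1 - stdPhiCDF s := by
  have hint : Integrable stdPhi := stdPhi_eq_gaussianPDFReal ▸ integrable_gaussianPDFReal 0 1
  have htotal : ∫ t, stdPhi t = 1 :=
    stdPhi_eq_gaussianPDFReal ▸ integral_gaussianPDFReal_eq_one 0 one_ne_zero
  rw [stdPhiCDF, ← htotal,
    ← intervalIntegral.integral_Iic_add_Ioi (b := s) hint.integrableOn hint.integrableOn,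
    add_sub_cancel_left]

lemma setIntegral_Ioi_mul_stdPhi (s : ℝ) : ∫ t in Set.Ioi s, t * stdPhi t = stdPhi s := by
  have hderiv (t : ℝ) : HasDerivAt (fun x => -stdPhi x) (t * stdPhi t) t :=
    (hasDerivAt_stdPhi t).neg.congr_deriv (neg_neg _)
  have hlim : Filter.Tendsto (fun x => -stdPhi x) Filter.atTop (nhds 0) := by
    simpa using (tendsto_pow_mul_stdPhi_atTop 0).neg
  have hint : Integrable (fun t : ℝ => t * stdPhi t) := by
    simpa using integrable_pow_mul_stdPhi 1
  rw [integral_Ioi_of_hasDerivAt_of_tendsto (hderiv s).continuousAt.continuousWithinAt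
    (fun t _ => hderiv t) hint.integrableOn hlim]
  ring

lemma setIntegral_Ioi_sq_mul_stdPhi (s : ℝ) :
    ∫ t in Set.Ioi s, t ^ 2 * stdPhi t = s * stdPhi s + (1 - stdPhiCDF s) := by
  have hderiv (t : ℝ) :
      HasDerivAt (fun x => -(x * stdPhi x)) (t ^ 2 * stdPhi t - stdPhi t) t :=
    ((hasDerivAt_id' t).mul (hasDerivAt_stdPhi t)).neg.congr_deriv (by ring)
  have hlim : Filter.Tendsto (fun x => -(x * stdPhi x)) Filter.atTop (nhds 0) := by
    simpa using (tendsto_pow_mul_stdPhi_atTop 1).neg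
  have hint₀ : Integrable stdPhi := by
    simpa using integrable_pow_mul_stdPhi 0
  have hint₂ := integrable_pow_mul_stdPhi 2
  have h := integral_Ioi_of_hasDerivAt_of_tendsto (hderiv s).continuousAt.continuousWithinAt
    (fun t _ => hderiv t) (hint₂.sub hint₀).integrableOn hlim
  rw [integral_sub hint₂.integrableOn hint₀.integrableOn, setIntegral_Ioi_stdPhi] at h
  linarith

lemma setIntegral_Ioi_pos {f : ℝ → ℝ} {s c : ℝ} (hf : ∀ t ∈ Set.Ioi s, 0 ≤ f t)
    (hpos : ∀ t, s < t → c < t → 0 < f t) (hint : IntegrableOn f (Set.Ioi s)) :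
    0 < ∫ t in Set.Ioi s, f t := by
  rw [setIntegral_pos_iff_support_of_nonneg_ae
    ((ae_restrict_iff' measurableSet_Ioi).2 (ae_of_all _ hf)) hint]
  have hsub : Set.Ioi (max s c) ⊆ Function.support f ∩ Set.Ioi s := fun t ht =>
    have ht' := max_lt_iff.1 ht
    ⟨(hpos t ht'.1 ht'.2).ne', ht'.1⟩
  refine lt_of_lt_of_le ?_ (measure_mono hsub)
  simp

lemma one_sub_stdPhiCDF_pos (s : ℝ) : 0 < 1 - stdPhiCDF s := by
  rw [← setIntegral_Ioi_stdPhi]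
  refine setIntegral_Ioi_pos (c := s) (fun t _ => (stdPhi_pos t).le)
    (fun t _ _ => stdPhi_pos t) ?_
  simpa using (integrable_pow_mul_stdPhi 0).integrableOn

lemma hazardN_pos (s : ℝ) : 0 < hazardN s :=
  div_pos (stdPhi_pos s) (one_sub_stdPhiCDF_pos s)

lemma mul_one_sub_stdPhiCDF_lt_stdPhi (s : ℝ) : s * (1 - stdPhiCDF s) < stdPhi s := by
  have hint₀ : Integrable stdPhi := by
    simpa using integrable_pow_mul_stdPhi 0
  have hint₁ : Integrable (fun t : ℝ => t * stdPhi t) := by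
    simpa using integrable_pow_mul_stdPhi 1
  have h : 0 < ∫ t in Set.Ioi s, (t * stdPhi t - s * stdPhi t) := by
    have hpos (t : ℝ) (ht : s < t) : 0 < t * stdPhi t - s * stdPhi t := by
      rw [← sub_mul]
      exact mul_pos (sub_pos.2 ht) (stdPhi_pos t)
    exact setIntegral_Ioi_pos (c := s) (fun t ht => (hpos t ht).le) (fun t ht _ => hpos t ht)
      (hint₁.sub (hint₀.const_mul s)).integrableOn
  rw [integral_sub hint₁.integrableOn (hint₀.const_mul s).integrableOn, integral_const_mul,
    setIntegral_Ioi_mul_stdPhi, setIntegral_Ioi_stdPhi] at h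
  linarith

lemma lt_hazardN (s : ℝ) : s < hazardN s :=
  (lt_div_iff₀ (one_sub_stdPhiCDF_pos s)).2 (mul_one_sub_stdPhiCDF_lt_stdPhi s)

/-- The second moment about `c` of the standard normal density on `(s, ∞)` is positive. -/
lemma second_moment_Ioi_pos (s c : ℝ) :
    0 < s * stdPhi s + (1 - stdPhiCDF s) - 2 * c * stdPhi s + c ^ 2 * (1 - stdPhiCDF s) := by
  have hint₀ : Integrable stdPhi := by
    simpa using integrable_pow_mul_stdPhi 0
  have hint₁ : Integrable (fun t : ℝ => t * stdPhi t) := by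
    simpa using integrable_pow_mul_stdPhi 1
  have hint₂ := integrable_pow_mul_stdPhi 2
  have hint₂₁ : Integrable (fun t : ℝ => t ^ 2 * stdPhi t - 2 * c * (t * stdPhi t)) :=
    hint₂.sub (hint₁.const_mul (2 * c))
  have h : 0 < ∫ t in Set.Ioi s,
      (t ^ 2 * stdPhi t - 2 * c * (t * stdPhi t) + c ^ 2 * stdPhi t) := by
    have heq (t : ℝ) : t ^ 2 * stdPhi t - 2 * c * (t * stdPhi t) + c ^ 2 * stdPhi t =
        (t - c) ^ 2 * stdPhi t := by ring
    refine setIntegral_Ioi_pos (c := c) (fun t _ => ?_) (fun t _ ht => ?_)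
      (hint₂₁.add (hint₀.const_mul (c ^ 2))).integrableOn
    · rw [heq]
      exact mul_nonneg (sq_nonneg _) (stdPhi_pos t).le
    · rw [heq]
      exact mul_pos (pow_pos (sub_pos.2 ht) 2) (stdPhi_pos t)
  rw [integral_add hint₂₁.integrableOn (hint₀.const_mul (c ^ 2)).integrableOn,
    integral_sub hint₂.integrableOn (hint₁.const_mul (2 * c)).integrableOn,
    integral_const_mul, integral_const_mul, setIntegral_Ioi_sq_mul_stdPhi,
    setIntegral_Ioi_mul_stdPhi, setIntegral_Ioi_stdPhi] at h
  exact h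

theorem stmt14 (s : ℝ) : 0 < psiN s ∧ psiN s < 1 := by
  refine ⟨mul_pos (hazardN_pos s) (sub_pos.2 (lt_hazardN s)), ?_⟩
  have hQ := one_sub_stdPhiCDF_pos s
  have hφ : stdPhi s = hazardN s * (1 - stdPhiCDF s) := (div_mul_cancel₀ _ hQ.ne').symm
  have h := second_moment_Ioi_pos s (hazardN s)
  have hfactor : 0 < (1 - psiN s) * (1 - stdPhiCDF s) := by
    rw [hφ] at h
    unfold psiN
    linarith
  exact sub_pos.1 (pos_of_mul_pos_left hfactor hQ.le)
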